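/- Let f : ℝ → ℝ be infinitely differentiable, let x ∈ ℝ with f′(x) ≠ 0, and let p ≥ 1 be a real exponent. Then the WENO-ZC+ weights are well defined for all sufficiently small Δx > 0 and satisfy, for each choice of sign, ω₀^{ZC+,±}(x,Δx) = d₀ − (3/100)·(f‴(x)/f′(x))·Δx² + O(Δx³), ω₁^{ZC+,±}(x,Δx) = d₁ + (6/50)·(f‴(x)/f′(x))·Δx² + O(Δx³), and ω₂^{ZC+,±}(x,Δx) = d₂ − (9/100)·(f‴(x)/f′(x))·Δx² + O(Δx³) as Δx → 0⁺; in particular the second-order deviation coefficients are identical for the right and left cell boundaries and sum to zero. -/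

import Mathlib

/-- The Jiang--Shu smoothness indicators `β₀, β₁, β₂`; the right-boundary
indicators are `wenoBeta f x Δx k` and the left-boundary ones are
`wenoBeta f (x - Δx) Δx k`. -/
noncomputable def wenoBeta (f : ℝ → ℝ) (x Δx : ℝ) : Fin 3 → ℝ
  | 0 => (1 / 4) * (f (x - 2 * Δx) - 4 * f (x - Δx) + 3 * f x) ^ 2
       + (13 / 12) * (f (x - 2 * Δx) - 2 * f (x - Δx) + f x) ^ 2
  | 1 => (1 / 4) * (f (x + Δx) - f (x - Δx)) ^ 2
       + (13 / 12) * (f (x - Δx) - 2 * f x + f (x + Δx)) ^ 2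
  | 2 => (1 / 4) * (3 * f x - 4 * f (x + Δx) + f (x + 2 * Δx)) ^ 2
       + (13 / 12) * (f x - 2 * f (x + Δx) + f (x + 2 * Δx)) ^ 2

/-- The global smoothness indicator `τ(x,Δx) = |β₂(x,Δx) − β₀(x,Δx)|`. -/
noncomputable def wenoTau (f : ℝ → ℝ) (x Δx : ℝ) : ℝ :=
  |wenoBeta f x Δx 2 - wenoBeta f x Δx 0|

/-- The mean smoothness indicator `β̄(x,Δx) = (β₀ + β₁ + β₂)/3`. -/
noncomputable def wenoBetaBar (f : ℝ → ℝ) (x Δx : ℝ) : ℝ :=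
  (wenoBeta f x Δx 0 + wenoBeta f x Δx 1 + wenoBeta f x Δx 2) / 3

/-- The ideal weights `(d₀, d₁, d₂) = (1/10, 6/10, 3/10)`. -/
noncomputable def wenoD : Fin 3 → ℝ
  | 0 => 1 / 10
  | 1 => 6 / 10
  | 2 => 3 / 10

/-- The centering coefficients `(c₀, c₁, c₂) = (3/4, 3/2, 3/4)`. -/
noncomputable def wenoCk : Fin 3 → ℝ
  | 0 => 3 / 4
  | 1 => 3 / 2
  | 2 => 3 / 4

/-- The unnormalized WENO-ZC+ weights (with `ε = 0` and real exponent `p`):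
`α_k^{ZC+} = d_k·[1 + c_k·(τ/β_k)^p·(τ/(τ + β̄))^p + β_k/(τ + β̄)]`. -/
noncomputable def alphaZCPlus (p : ℝ) (f : ℝ → ℝ) (x Δx : ℝ) (k : Fin 3) : ℝ :=
  wenoD k * (1 + wenoCk k * (wenoTau f x Δx / wenoBeta f x Δx k) ^ p *
      (wenoTau f x Δx / (wenoTau f x Δx + wenoBetaBar f x Δx)) ^ p
    + wenoBeta f x Δx k / (wenoTau f x Δx + wenoBetaBar f x Δx))

/-- The normalized WENO-ZC+ weights. -/
noncomputable def omegaZCPlus (p : ℝ) (f : ℝ → ℝ) (x Δx : ℝ) (k : Fin 3) : ℝ :=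
  alphaZCPlus p f x Δx k / (∑ j : Fin 3, alphaZCPlus p f x Δx j)

open Filter Topology in
/-- Bounded near `0⁺`. -/
def ZBd (g : ℝ → ℝ) : Prop := ∃ M : ℝ, ∀ᶠ h in 𝓝[>] (0 : ℝ), |g h| ≤ M

lemma ZBd.const (c : ℝ) : ZBd (fun _ => c) := ⟨|c|, by simp⟩

open Filter Topology in
lemma ZBd.id : ZBd (fun h => h) := by
  refine ⟨1, ?_⟩
  have : Set.Ioo (0 : ℝ) 1 ∈ 𝓝[>] (0 : ℝ) := Ioo_mem_nhdsGT one_pos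
  filter_upwards [this] with h hh
  rw [abs_of_pos hh.1]; exact hh.2.le

lemma ZBd.add {g k : ℝ → ℝ} (hg : ZBd g) (hk : ZBd k) : ZBd (fun h => g h + k h) := by
  obtain ⟨M, hM⟩ := hg
  obtain ⟨N, hN⟩ := hk
  refine ⟨M + N, ?_⟩
  filter_upwards [hM, hN] with h h1 h2
  exact (abs_add_le _ _).trans (add_le_add h1 h2)

lemma ZBd.mul {g k : ℝ → ℝ} (hg : ZBd g) (hk : ZBd k) : ZBd (fun h => g h * k h) := by
  obtain ⟨M, hM⟩ := hg
  obtain ⟨N, hN⟩ := hk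
  refine ⟨M * N, ?_⟩
  filter_upwards [hM, hN] with h h1 h2
  rw [abs_mul]
  exact mul_le_mul h1 h2 (abs_nonneg _) ((abs_nonneg _).trans h1)

lemma ZBd.sub {g k : ℝ → ℝ} (hg : ZBd g) (hk : ZBd k) : ZBd (fun h => g h - k h) := by
  have := hg.add ((ZBd.const (-1)).mul hk)
  simpa [sub_eq_add_neg] using this

lemma ZBd.pow {g : ℝ → ℝ} (hg : ZBd g) (n : ℕ) : ZBd (fun h => g h ^ n) := by
  obtain ⟨M, hM⟩ := hg
  refine ⟨M ^ n, ?_⟩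
  filter_upwards [hM] with h h1
  rw [abs_pow]
  exact pow_le_pow_left₀ (abs_nonneg _) h1 n

lemma ZBd.abs {g : ℝ → ℝ} (hg : ZBd g) : ZBd (fun h => |g h|) := by
  simpa [ZBd] using hg

open Filter Topology in
lemma ZBd.mono {g k : ℝ → ℝ} (hk : ZBd k) (h : ∀ᶠ t in 𝓝[>] (0 : ℝ), |g t| ≤ k t) : ZBd g := by
  obtain ⟨M, hM⟩ := hk
  refine ⟨M, ?_⟩
  filter_upwards [hM, h] with t h1 h2
  exact h2.trans ((le_abs_self _).trans h1)

open Filter Topology in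
lemma ZBd.div {g k : ℝ → ℝ} (hg : ZBd g) {m : ℝ} (hm : 0 < m)
    (hk : ∀ᶠ t in 𝓝[>] (0 : ℝ), m ≤ k t) : ZBd (fun h => g h / k h) := by
  refine ZBd.mono (hg.abs.mul (ZBd.const m⁻¹)) ?_
  filter_upwards [hk] with t ht
  rw [abs_div, abs_of_pos (hm.trans_le ht), div_eq_mul_inv]
  gcongr

open Filter Topology in
lemma ZBd.low {z : ℝ → ℝ} (hz : ZBd z) {m : ℝ} (hm : 0 < m) :
    ∀ᶠ t in 𝓝[>] (0 : ℝ), m / 2 ≤ m + t * z t := by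
  obtain ⟨M, hM⟩ := hz
  have hp : 0 < m / (2 * (|M| + 1)) := by positivity
  filter_upwards [hM, Ioo_mem_nhdsGT hp] with t ht h2
  have h3 : t * (|M| + 1) < m / 2 := by
    have := (lt_div_iff₀ (by positivity)).1 h2.2
    linarith
  have h4 : -(|M| + 1) ≤ z t := by
    have := neg_abs_le (z t)
    have := le_abs_self M
    linarith
  nlinarith [h2.1, mul_le_mul_of_nonneg_left h4 h2.1.le]

open Filter Topology in
lemma zTaylor (f : ℝ → ℝ) (hf : ContDiff ℝ (⊤ : ℕ∞) f) (x m : ℝ) :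
    ∃ r : ℝ → ℝ, ZBd r ∧ ∀ h > 0, f (x + m * h) = f x + deriv f x * (m * h)
      + iteratedDeriv 2 f x * (m * h) ^ 2 / 2 + iteratedDeriv 3 f x * (m * h) ^ 3 / 6
      + h ^ 4 * r h := by
  refine ⟨fun h => (f (x + m * h) - (f x + deriv f x * (m * h)
      + iteratedDeriv 2 f x * (m * h) ^ 2 / 2 + iteratedDeriv 3 f x * (m * h) ^ 3 / 6)) / h ^ 4,
      ?_, ?_⟩
  · have h4 : ContDiff ℝ (4 : ℕ) f := contDiff_infty.1 hf 4
    have hT := (taylor_isLittleO_univ (x₀ := x) h4).isBigO.bound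
    obtain ⟨C, hC⟩ := (taylor_isLittleO_univ (x₀ := x) h4).isBigO.bound
    have ht : Tendsto (fun h : ℝ => x + m * h) (𝓝[>] 0) (𝓝 x) := by
      have : Tendsto (fun h : ℝ => x + m * h) (𝓝 0) (𝓝 (x + m * 0)) :=
        (by fun_prop : Continuous (fun h : ℝ => x + m * h)).tendsto 0
      simp only [mul_zero, add_zero] at this
      exact this.mono_left nhdsWithin_le_nhds
    refine ⟨C * m ^ 4 + |iteratedDeriv 4 f x * m ^ 4 / 24|, ?_⟩
    filter_upwards [ht.eventually hC, self_mem_nhdsWithin] with h hh hpos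
    have hpos' : 0 < h := hpos
    simp only [taylor_within_apply, Finset.sum_range_succ, Finset.sum_range_zero,
      iteratedDerivWithin_univ, Nat.factorial, iteratedDeriv_zero, iteratedDeriv_one,
      Real.norm_eq_abs, smul_eq_mul, add_sub_cancel_left] at hh
    rw [abs_div, abs_of_pos (pow_pos hpos' 4), div_le_iff₀ (pow_pos hpos' 4)]
    have e : |(m * h) ^ 4| = m ^ 4 * h ^ 4 := by
      rw [abs_of_nonneg (by positivity)]; ring
    rw [e] at hh
    have e2 : |iteratedDeriv 4 f x * m ^ 4 / 24| * h ^ 4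
        = |iteratedDeriv 4 f x * m ^ 4 / 24 * h ^ 4| := by
      rw [abs_mul, abs_of_pos (pow_pos hpos' 4)]
    rw [add_mul, e2]
    refine le_trans (le_of_eq ?_) ((abs_add_le _ _).trans (add_le_add_left (hh.trans (le_of_eq (mul_assoc _ _ _).symm)) _))
    congr 1
    push_cast
    ring
  · intro h hh
    field_simp
    ring

/-- Taylor coefficients of the second order deviations. -/
noncomputable def zK : Fin 3 → ℝ
  | 0 => -1 / 3
  | 1 => 2 / 3
  | 2 => -1 / 3

lemma zForm {w u v : ℝ → ℝ} (hw : ZBd w) (hu : ZBd u) (hv : ZBd v) (a b c κ : ℝ) :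
    ∃ n : ℝ → ℝ, ZBd n ∧ ∀ h U V : ℝ,
      U = h * (2 * (a + h * w h) + (κ - 1 / 3) * c * h ^ 2 + h ^ 3 * u h) →
      V = h ^ 2 * (b + h * v h) →
      (1 / 4) * U ^ 2 + (13 / 12) * V ^ 2 = h ^ 2 * ((a + h * w h) ^ 2
        + (13 / 12 * b ^ 2 - a * c / 3 + κ * (a * c)) * h ^ 2 + h ^ 3 * n h) := by
  refine ⟨fun h => (κ - 1 / 3) * c * w h + (a + h * w h) * u h
    + (1 / 4) * h * ((κ - 1 / 3) * c + h * u h) ^ 2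
    + (13 / 12) * (2 * b * v h + h * v h ^ 2), ?_, ?_⟩
  · repeat' first
      | exact hw | exact hu | exact hv | exact ZBd.id | exact ZBd.const _
      | apply ZBd.sub | apply ZBd.add | apply ZBd.mul | apply ZBd.pow
  · rintro h U V rfl rfl
    ring

lemma zBeta (f : ℝ → ℝ) (hf : ContDiff ℝ (⊤ : ℕ∞) f) (x s : ℝ) :
    ∃ (w : ℝ → ℝ) (n : Fin 3 → ℝ → ℝ), ZBd w ∧ (∀ k, ZBd (n k)) ∧ ∀ h > 0, ∀ k,
      wenoBeta f (x + s * h) h k = h ^ 2 * ((deriv f x + h * w h) ^ 2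
        + (13 / 12 * iteratedDeriv 2 f x ^ 2 - deriv f x * iteratedDeriv 3 f x / 3
          + zK k * (deriv f x * iteratedDeriv 3 f x)) * h ^ 2 + h ^ 3 * n k h) := by
  obtain ⟨r0, b0, e0⟩ := zTaylor f hf x s
  obtain ⟨r1, b1, e1⟩ := zTaylor f hf x (s + 1)
  obtain ⟨r2, b2, e2⟩ := zTaylor f hf x (s + 2)
  obtain ⟨r3, b3, e3⟩ := zTaylor f hf x (s - 1)
  obtain ⟨r4, b4, e4⟩ := zTaylor f hf x (s - 2)
  set a := deriv f x
  set b := iteratedDeriv 2 f x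
  set c := iteratedDeriv 3 f x
  have hw : ZBd (fun h => s * b + s ^ 2 * c / 2 * h) :=
    (ZBd.const _).add ((ZBd.const _).mul ZBd.id)
  have hu0 : ZBd (fun h => r4 h - 4 * r3 h + 3 * r0 h) :=
    (b4.sub ((ZBd.const _).mul b3)).add ((ZBd.const _).mul b0)
  have hv0 : ZBd (fun h => (s - 1) * c + h * (r4 h - 2 * r3 h + r0 h)) :=
    (ZBd.const _).add (ZBd.id.mul ((b4.sub ((ZBd.const _).mul b3)).add b0))
  have hu1 : ZBd (fun h => r1 h - r3 h) := b1.sub b3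
  have hv1 : ZBd (fun h => s * c + h * (r3 h - 2 * r0 h + r1 h)) :=
    (ZBd.const _).add (ZBd.id.mul ((b3.sub ((ZBd.const _).mul b0)).add b1))
  have hu2 : ZBd (fun h => 4 * r1 h - r2 h - 3 * r0 h) :=
    (((ZBd.const _).mul b1).sub b2).sub ((ZBd.const _).mul b0)
  have hv2 : ZBd (fun h => (s + 1) * c + h * (r0 h - 2 * r1 h + r2 h)) :=
    (ZBd.const _).add (ZBd.id.mul ((b0.sub ((ZBd.const _).mul b1)).add b2))
  obtain ⟨n0, hn0, g0⟩ := zForm hw hu0 hv0 a b c (-1 / 3)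
  obtain ⟨n1, hn1, g1⟩ := zForm hw hu1 hv1 a b c (2 / 3)
  obtain ⟨n2, hn2, g2⟩ := zForm hw hu2 hv2 a b c (-1 / 3)
  refine ⟨_, ![n0, n1, n2], hw, ?_, ?_⟩
  · intro k
    fin_cases k
    · exact hn0
    · exact hn1
    · exact hn2
  · intro h hh k
    have q1 : x + s * h + h = x + (s + 1) * h := by ring
    have q2 : x + s * h + 2 * h = x + (s + 2) * h := by ring
    have q3 : x + s * h - h = x + (s - 1) * h := by ring
    have q4 : x + s * h - 2 * h = x + (s - 2) * h := by ring
    fin_cases k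
    · refine g0 h _ _ ?_ ?_
      · rw [q3, q4, e0 h hh, e3 h hh, e4 h hh]; ring
      · rw [q3, q4, e0 h hh, e3 h hh, e4 h hh]; ring
    · refine g1 h _ _ ?_ ?_
      · rw [q3, q1, e1 h hh, e3 h hh]; ring
      · rw [q3, q1, e0 h hh, e3 h hh, e1 h hh]; ring
    · have := g2 h (-(3 * f (x + s * h) - 4 * f (x + s * h + h) + f (x + s * h + 2 * h)))
        (f (x + s * h) - 2 * f (x + s * h + h) + f (x + s * h + 2 * h)) ?_ ?_
      · rw [neg_sq] at this
        exact this
      · rw [q1, q2, e0 h hh, e1 h hh, e2 h hh]; ring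
      · rw [q1, q2, e0 h hh, e1 h hh, e2 h hh]; ring

open Filter Topology in
/-- Expansion of the unnormalized weights. -/
lemma zAlpha (f : ℝ → ℝ) (hf : ContDiff ℝ (⊤ : ℕ∞) f) (x : ℝ) (hx : deriv f x ≠ 0)
    (p : ℝ) (hp : 1 ≤ p) (s : ℝ) :
    (∀ᶠ h in 𝓝[>] (0 : ℝ), (∀ k, 0 < wenoBeta f (x + s * h) h k) ∧
      0 < wenoTau f (x + s * h) h + wenoBetaBar f (x + s * h) h ∧
      ∀ k, wenoD k ≤ alphaZCPlus p f (x + s * h) h k) ∧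
    ∃ σ : Fin 3 → ℝ → ℝ, (∀ k, ZBd (σ k)) ∧ ∀ᶠ h in 𝓝[>] (0 : ℝ), ∀ k,
      alphaZCPlus p f (x + s * h) h k =
        wenoD k * (2 + zK k * (iteratedDeriv 3 f x / deriv f x) * h ^ 2 + h ^ 3 * σ k h) := by
  obtain ⟨w, n, hw, hn, hβ⟩ := zBeta f hf x s
  set a := deriv f x
  set b := iteratedDeriv 2 f x
  set c := iteratedDeriv 3 f x
  set E := 13 / 12 * b ^ 2 - a * c / 3
  have ha : 0 < a ^ 2 := by positivity
  have ha2 : 0 < a ^ 2 / 2 := by positivity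
  obtain ⟨N, hN⟩ : ∃ N : Fin 3 → ℝ → ℝ, ∀ k h, N k h =
    (a + h * w h) ^ 2 + (E + zK k * (a * c)) * h ^ 2 + h ^ 3 * n k h := ⟨_, fun _ _ => rfl⟩
  obtain ⟨T, hT⟩ : ∃ T : ℝ → ℝ, ∀ h, T h = |n 2 h - n 0 h| := ⟨_, fun _ => rfl⟩
  have bT : ZBd T := by
    have := ((hn 2).sub (hn 0)).abs
    rwa [show T = fun h => |n 2 h - n 0 h| from funext hT]
  obtain ⟨u, hu⟩ : ∃ u : ℝ → ℝ, ∀ h, u h = T h + (n 0 h + n 1 h + n 2 h) * (1 / 3) :=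
    ⟨_, fun _ => rfl⟩
  have bu : ZBd u := by
    rw [show u = fun h => T h + (n 0 h + n 1 h + n 2 h) * (1 / 3) from funext hu]
    exact bT.add ((((hn 0).add (hn 1)).add (hn 2)).mul (ZBd.const _))
  obtain ⟨D, hD⟩ : ∃ D : ℝ → ℝ, ∀ h, D h = (a + h * w h) ^ 2 + E * h ^ 2 + h ^ 3 * u h :=
    ⟨_, fun _ => rfl⟩
  -- lower bounds
  have lowgen : ∀ (e : ℝ) (z : ℝ → ℝ), ZBd z → ∀ᶠ h in 𝓝[>] (0 : ℝ),
      a ^ 2 / 2 ≤ (a + h * w h) ^ 2 + e * h ^ 2 + h ^ 3 * z h := by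
    intro e z hz
    have : ZBd (fun h => 2 * a * w h + h * w h ^ 2 + e * h + h ^ 2 * z h) := by
      repeat' first
        | exact hw | exact hz | exact ZBd.id | exact ZBd.const _
        | apply ZBd.sub | apply ZBd.add | apply ZBd.mul | apply ZBd.pow
    filter_upwards [this.low ha] with h hh
    refine hh.trans (le_of_eq (by ring))
  have lN : ∀ k, ∀ᶠ h in 𝓝[>] (0 : ℝ), a ^ 2 / 2 ≤ N k h := by
    intro k
    simp only [hN]
    exact lowgen _ _ (hn k)
  have lD : ∀ᶠ h in 𝓝[>] (0 : ℝ), a ^ 2 / 2 ≤ D h := by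
    simp only [hD]
    exact lowgen _ _ bu
  have pos : ∀ᶠ h in 𝓝[>] (0 : ℝ), 0 < h := self_mem_nhdsWithin
  have hβ' : ∀ h > 0, ∀ k, wenoBeta f (x + s * h) h k = h ^ 2 * N k h := by
    intro h hh k
    rw [hN]; exact hβ h hh k
  have hτ : ∀ h > 0, wenoTau f (x + s * h) h = h ^ 5 * T h := by
    intro h hh
    rw [wenoTau, hβ' h hh, hβ' h hh, hN, hN, hT, ← abs_of_pos (pow_pos hh 5), ← abs_mul]
    congr 1
    simp only [zK]
    ring
  have hDD : ∀ h > 0, wenoTau f (x + s * h) h + wenoBetaBar f (x + s * h) h = h ^ 2 * D h := by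
    intro h hh
    rw [hτ h hh, wenoBetaBar, hβ' h hh, hβ' h hh, hβ' h hh, hN, hN, hN, hD, hu]
    simp only [zK]
    ring
  have hT0 : ∀ h, 0 ≤ T h := fun h => by rw [hT]; exact abs_nonneg _
  -- the power term
  obtain ⟨θ, hθ⟩ : ∃ θ : Fin 3 → ℝ → ℝ, ∀ k h, θ k h =
    wenoCk k * (wenoTau f (x + s * h) h / wenoBeta f (x + s * h) h k) ^ p *
      (wenoTau f (x + s * h) h / (wenoTau f (x + s * h) h + wenoBetaBar f (x + s * h) h)) ^ p :=
    ⟨_, fun _ _ => rfl⟩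
  have hCk : ∀ k, 0 ≤ wenoCk k := by
    intro k; fin_cases k <;> norm_num [wenoCk]
  have hd : ∀ k, 0 < wenoD k := by
    intro k; fin_cases k <;> norm_num [wenoD]
  have small : ∀ k, ∀ᶠ h in 𝓝[>] (0 : ℝ), h ^ 3 * (T h / N k h) ≤ 1 := by
    intro k
    have : ZBd (fun h => -1 * (h ^ 2 * (T h / N k h))) :=
      (ZBd.const _).mul ((ZBd.id.pow 2).mul (bT.div ha2 (lN k)))
    filter_upwards [this.low one_pos] with h hh
    nlinarith
  have hθb : ∀ k, ∀ᶠ h in 𝓝[>] (0 : ℝ), 0 ≤ θ k h ∧ θ k h ≤ wenoCk k * (h ^ 3 * (T h / N k h)) := by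
    intro k
    filter_upwards [lN k, lD, pos, small k] with h h1 h2 h3 h4
    have hN0 : 0 < N k h := ha2.trans_le h1
    have hD0 : 0 < D h := ha2.trans_le h2
    have e1 : wenoTau f (x + s * h) h / wenoBeta f (x + s * h) h k = h ^ 3 * (T h / N k h) := by
      rw [hτ h h3, hβ' h h3]
      field_simp
    have t0 : 0 ≤ wenoTau f (x + s * h) h := abs_nonneg _
    have bb0 : 0 ≤ wenoBetaBar f (x + s * h) h := by
      have : ∀ k, 0 ≤ wenoBeta f (x + s * h) h k := by
        intro k; fin_cases k <;> simp only [wenoBeta] <;> positivity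
      have h0 := this 0
      have h1 := this 1
      have h2 := this 2
      rw [wenoBetaBar]; positivity
    have hr0 : 0 ≤ wenoTau f (x + s * h) h /
      (wenoTau f (x + s * h) h + wenoBetaBar f (x + s * h) h) := by positivity
    have hr1 : wenoTau f (x + s * h) h /
      (wenoTau f (x + s * h) h + wenoBetaBar f (x + s * h) h) ≤ 1 :=
      div_le_one_of_le₀ (by linarith) (by linarith)
    rw [hθ, e1]
    have hz0 : 0 ≤ h ^ 3 * (T h / N k h) := by have := hT0 h; positivity
    have y1 : (h ^ 3 * (T h / N k h)) ^ p ≤ h ^ 3 * (T h / N k h) := by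
      have := Real.rpow_le_rpow_of_exponent_ge_of_imp hz0 h4 hp (by intro _ h; linarith)
      simpa using this
    have y2 := Real.rpow_le_one hr0 hr1 (by linarith : 0 ≤ p)
    have y3 := Real.rpow_nonneg hr0 p
    have y4 := Real.rpow_nonneg hz0 p
    have hc := hCk k
    refine ⟨by positivity, ?_⟩
    calc _ ≤ wenoCk k * (h ^ 3 * (T h / N k h)) ^ p * 1 := by gcongr
      _ ≤ _ := by rw [mul_one]; gcongr
  have bθ : ∀ k, ZBd (fun h => θ k h / h ^ 3) := by
    intro k
    refine ZBd.mono ((ZBd.const (wenoCk k)).mul (bT.div ha2 (lN k))) ?_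
    filter_upwards [hθb k, pos] with h h1 h2
    rw [abs_of_nonneg (div_nonneg h1.1 (by positivity)), div_le_iff₀ (by positivity)]
    linarith [h1.2]
  have hα : ∀ k, ∀ h > 0, 0 < D h → alphaZCPlus p f (x + s * h) h k =
      wenoD k * (1 + θ k h + N k h / D h) := by
    intro k h h0 hD0
    rw [alphaZCPlus, ← hθ, hDD h h0, hβ' h h0, mul_div_mul_left _ _ (by positivity)]
  constructor
  · filter_upwards [eventually_all.2 lN, lD, pos, eventually_all.2 hθb] with h h1 h2 h3 h4
    have hD0 : 0 < D h := ha2.trans_le h2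
    refine ⟨fun k => ?_, ?_, fun k => ?_⟩
    · rw [hβ' h h3]
      have := ha2.trans_le (h1 k)
      positivity
    · rw [hDD h h3]; positivity
    · rw [hα k h h3 hD0]
      have hN0 := ha2.trans_le (h1 k)
      have := (h4 k).1
      have h5 : 0 ≤ N k h / D h := by positivity
      exact le_mul_of_one_le_right (hd k).le (by linarith)
  · refine ⟨fun k h => θ k h / h ^ 3 + (n k h - u h - zK k * (c / a) *
      (2 * a * w h + h * w h ^ 2 + E * h + h ^ 2 * u h)) / D h, fun k => ?_, ?_⟩
    · refine (bθ k).add (ZBd.div ?_ ha2 lD)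
      have hnk := hn k
      repeat' first
        | exact hw | exact bu | exact hnk | exact ZBd.id | exact ZBd.const _
        | apply ZBd.sub | apply ZBd.add | apply ZBd.mul | apply ZBd.pow
    · filter_upwards [lD, pos] with h h2 h3 k
      have hD0 : 0 < D h := ha2.trans_le h2
      rw [hα k h h3 hD0]
      congr 1
      have key : N k h / D h = 1 + zK k * (c / a) * h ^ 2 + h ^ 3 * ((n k h - u h - zK k * (c / a) *
          (2 * a * w h + h * w h ^ 2 + E * h + h ^ 2 * u h)) / D h) := by
        have : N k h = (1 + zK k * (c / a) * h ^ 2) * D h + h ^ 3 * (n k h - u h - zK k * (c / a) *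
          (2 * a * w h + h * w h ^ 2 + E * h + h ^ 2 * u h)) := by
          rw [hN, hD]
          have : a * c = c / a * a ^ 2 := by field_simp
          rw [this]
          ring
        rw [this, add_div, mul_div_cancel_right₀ _ hD0.ne', mul_div_assoc]
      rw [key]
      field_simp
      ring

/-- The second order deviation coefficients. -/
noncomputable def zM : Fin 3 → ℝ
  | 0 => -3 / 100
  | 1 => 6 / 50
  | 2 => -9 / 100

open Filter Topology in
lemma zOmega (f : ℝ → ℝ) (hf : ContDiff ℝ (⊤ : ℕ∞) f) (x : ℝ) (hx : deriv f x ≠ 0)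
    (p : ℝ) (hp : 1 ≤ p) (s : ℝ) :
    ∃ C : ℝ, ∀ᶠ h in 𝓝[>] (0 : ℝ), (∀ k, wenoBeta f (x + s * h) h k ≠ 0) ∧
      wenoTau f (x + s * h) h + wenoBetaBar f (x + s * h) h ≠ 0 ∧
      (∑ j : Fin 3, alphaZCPlus p f (x + s * h) h j) ≠ 0 ∧
      ∀ k, |omegaZCPlus p f (x + s * h) h k -
        (wenoD k + zM k * (iteratedDeriv 3 f x / deriv f x) * h ^ 2)| ≤ C * h ^ 3 := by
  obtain ⟨h1, σ, hσ, h2⟩ := zAlpha f hf x hx p hp s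
  set g := iteratedDeriv 3 f x / deriv f x
  obtain ⟨Sg, hSg⟩ : ∃ S : ℝ → ℝ, ∀ h, S h = 1 / 10 * σ 0 h + 6 / 10 * σ 1 h + 3 / 10 * σ 2 h :=
    ⟨_, fun _ => rfl⟩
  have bSg : ZBd Sg := by
    rw [show Sg = fun h => 1 / 10 * σ 0 h + 6 / 10 * σ 1 h + 3 / 10 * σ 2 h from funext hSg]
    exact (((ZBd.const _).mul (hσ 0)).add ((ZBd.const _).mul (hσ 1))).add
      ((ZBd.const _).mul (hσ 2))
  have hB : ∀ k, ZBd (fun h => wenoD k * σ k h - (wenoD k + zM k * g * h ^ 2) * Sg h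
      - zM k * g * (4 / 15 * g) * h) := by
    intro k
    have hk := hσ k
    repeat' first
      | exact bSg | exact hk | exact ZBd.id | exact ZBd.const _
      | apply ZBd.sub | apply ZBd.add | apply ZBd.mul | apply ZBd.pow
  choose M hM using hB
  refine ⟨|M 0| + |M 1| + |M 2|, ?_⟩
  filter_upwards [h1, h2, self_mem_nhdsWithin, eventually_all.2 hM] with h h1 h2 h3 hM
  have h3' : 0 < h := h3
  obtain ⟨hb, ht, hα⟩ := h1
  have hS : (∑ j : Fin 3, alphaZCPlus p f (x + s * h) h j) = 2 + 4 / 15 * g * h ^ 2 + h ^ 3 * Sg h := by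
    rw [Fin.sum_univ_three, h2, h2, h2, hSg]
    simp only [wenoD, zK]
    ring
  have hS1 : 1 ≤ (∑ j : Fin 3, alphaZCPlus p f (x + s * h) h j) := by
    have h0 := hα 0
    have h1 := hα 1
    have h2 := hα 2
    rw [Fin.sum_univ_three]
    simp only [wenoD] at h0 h1 h2
    linarith
  have hS0 := zero_lt_one.trans_le hS1
  refine ⟨fun k => (hb k).ne', ht.ne', hS0.ne', fun k => ?_⟩
  have hMk : |M k| ≤ |M 0| + |M 1| + |M 2| := by
    have := abs_nonneg (M 0)
    have := abs_nonneg (M 1)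
    have := abs_nonneg (M 2)
    fin_cases k <;> simp <;> linarith
  have rel : 2 * zM k + wenoD k * (4 / 15) = wenoD k * zK k := by
    fin_cases k <;> norm_num [zM, zK, wenoD]
  have key : omegaZCPlus p f (x + s * h) h k - (wenoD k + zM k * g * h ^ 2) =
      h ^ 3 * (wenoD k * σ k h - (wenoD k + zM k * g * h ^ 2) * Sg h
      - zM k * g * (4 / 15 * g) * h) / (∑ j : Fin 3, alphaZCPlus p f (x + s * h) h j) := by
    rw [omegaZCPlus, eq_div_iff hS0.ne', sub_mul, div_mul_cancel₀ _ hS0.ne', hS, h2]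
    linear_combination (-g * h ^ 2) * rel
  rw [key, abs_div, abs_of_pos hS0, abs_mul, abs_of_pos (pow_pos h3' 3)]
  refine (div_le_self (by positivity) hS1).trans ?_
  rw [mul_comm]
  gcongr
  exact (hM k).trans ((le_abs_self _).trans hMk)

/-- away from critical points (`f′(x) ≠ 0`), for `p ≥ 1`, the
WENO-ZC+ weights are well defined for all sufficiently small `Δx > 0` and, for
each choice of sign (the left-boundary quantities are those based at `x − Δx`),
`ω₀^{ZC+,±} = d₀ − (3/100)(f‴/f′)Δx² + O(Δx³)`,
`ω₁^{ZC+,±} = d₁ + (6/50)(f‴/f′)Δx² + O(Δx³)`, and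
`ω₂^{ZC+,±} = d₂ − (9/100)(f‴/f′)Δx² + O(Δx³)` as `Δx → 0⁺`. -/
theorem weno_zcplus_weights_no_critical_point
    (f : ℝ → ℝ) (hf : ContDiff ℝ (⊤ : ℕ∞) f) (x : ℝ) (hx : deriv f x ≠ 0)
    (p : ℝ) (hp : 1 ≤ p) :
    ∃ δ > (0 : ℝ),
      (∀ Δx : ℝ, 0 < Δx → Δx < δ →
        (∀ k : Fin 3, wenoBeta f x Δx k ≠ 0) ∧
        (∀ k : Fin 3, wenoBeta f (x - Δx) Δx k ≠ 0) ∧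
        wenoTau f x Δx + wenoBetaBar f x Δx ≠ 0 ∧
        wenoTau f (x - Δx) Δx + wenoBetaBar f (x - Δx) Δx ≠ 0 ∧
        (∑ j : Fin 3, alphaZCPlus p f x Δx j) ≠ 0 ∧
        (∑ j : Fin 3, alphaZCPlus p f (x - Δx) Δx j) ≠ 0) ∧
      ∃ C > (0 : ℝ), ∀ Δx : ℝ, 0 < Δx → Δx < δ →
        |omegaZCPlus p f x Δx 0 -
          (wenoD 0 - (3 / 100) * (iteratedDeriv 3 f x / deriv f x) * Δx ^ 2)|
            ≤ C * Δx ^ 3 ∧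
        |omegaZCPlus p f (x - Δx) Δx 0 -
          (wenoD 0 - (3 / 100) * (iteratedDeriv 3 f x / deriv f x) * Δx ^ 2)|
            ≤ C * Δx ^ 3 ∧
        |omegaZCPlus p f x Δx 1 -
          (wenoD 1 + (6 / 50) * (iteratedDeriv 3 f x / deriv f x) * Δx ^ 2)|
            ≤ C * Δx ^ 3 ∧
        |omegaZCPlus p f (x - Δx) Δx 1 -
          (wenoD 1 + (6 / 50) * (iteratedDeriv 3 f x / deriv f x) * Δx ^ 2)|
            ≤ C * Δx ^ 3 ∧
        |omegaZCPlus p f x Δx 2 -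
          (wenoD 2 - (9 / 100) * (iteratedDeriv 3 f x / deriv f x) * Δx ^ 2)|
            ≤ C * Δx ^ 3 ∧
        |omegaZCPlus p f (x - Δx) Δx 2 -
          (wenoD 2 - (9 / 100) * (iteratedDeriv 3 f x / deriv f x) * Δx ^ 2)|
            ≤ C * Δx ^ 3 := by
  obtain ⟨C₁, e₁⟩ := zOmega f hf x hx p hp 0
  obtain ⟨C₂, e₂⟩ := zOmega f hf x hx p hp (-1)
  obtain ⟨δ, hδ, hsub⟩ := mem_nhdsGT_iff_exists_Ioo_subset.1 (e₁.and e₂)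
  have key := fun (h : ℝ) (h0 : 0 < h) (h1 : h < δ) => hsub ⟨h0, h1⟩
  simp only [Set.mem_ofPred_eq, zero_mul, add_zero, neg_mul, one_mul, ← sub_eq_add_neg] at key
  refine ⟨δ, hδ, ?_, |C₁| + |C₂| + 1, by positivity, ?_⟩
  · intro h h0 h1
    obtain ⟨⟨a1, a2, a3, -⟩, b1, b2, b3, -⟩ := key h h0 h1
    exact ⟨a1, b1, a2, b2, a3, b3⟩
  · intro h h0 h1
    obtain ⟨⟨-, -, -, a⟩, -, -, -, b⟩ := key h h0 h1
    have c1 : C₁ * h ^ 3 ≤ (|C₁| + |C₂| + 1) * h ^ 3 := by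
      gcongr
      have := le_abs_self C₁
      have := abs_nonneg C₂
      linarith
    have c2 : C₂ * h ^ 3 ≤ (|C₁| + |C₂| + 1) * h ^ 3 := by
      gcongr
      have := le_abs_self C₂
      have := abs_nonneg C₁
      linarith
    have m0 : ∀ g : ℝ, wenoD 0 + zM 0 * g * h ^ 2 = wenoD 0 - 3 / 100 * g * h ^ 2 := by
      intro g; simp only [zM]; ring
    have m1 : ∀ g : ℝ, wenoD 1 + zM 1 * g * h ^ 2 = wenoD 1 + 6 / 50 * g * h ^ 2 := by
      intro g; simp only [zM]
    have m2 : ∀ g : ℝ, wenoD 2 + zM 2 * g * h ^ 2 = wenoD 2 - 9 / 100 * g * h ^ 2 := by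
      intro g; simp only [zM]; ring
    rw [← m0, ← m1, ← m2]
    exact ⟨(a 0).trans c1, (b 0).trans c2, (a 1).trans c1, (b 1).trans c2,
      (a 2).trans c1, (b 2).trans c2⟩
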